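/- Failure of the Schur product property on the dual of the rank-7 example: With M₁, …, M₇ the seven explicit matrices listed in the context, let u = (1,0,0,0,1,−3,2) and d = (1,5,5,5,6,7,7). Then (i) M_j · u = u_j · u for every j ∈ {1,…,7}; (ii) Σ_{j=1}^{7} u_j³/d_j = 1/1 + 0 + 0 + 0 + 1/6 + (−27)/7 + 8/7 = −65/42 < 0; and (iii) the symmetric rational matrix Z := Σ_{j=1}^{7} (u_j²/d_j)·M_j = M₁ + (1/6)·M₅ + (9/7)·M₆ + (4/7)·M₇ satisfies Z·u = (−65/42)·u, hence Z is not positive semidefinite, even though X := M₁ + M₅ − 3M₆ + 2M₇ = Σ_j u_j M_j is positive semidefinite. -/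

import Mathlib

def M₁ : Matrix (Fin 7) (Fin 7) ℚ := 1

def M₂ : Matrix (Fin 7) (Fin 7) ℚ :=
  !![0,1,0,0,0,0,0; 1,1,0,1,0,1,1; 0,0,1,0,1,1,1; 0,1,0,0,1,1,1;
     0,0,1,1,1,1,1; 0,1,1,1,1,1,1; 0,1,1,1,1,1,1]

def M₃ : Matrix (Fin 7) (Fin 7) ℚ :=
  !![0,0,1,0,0,0,0; 0,0,1,0,1,1,1; 1,1,1,0,0,1,1; 0,0,0,1,1,1,1;
     0,1,0,1,1,1,1; 0,1,1,1,1,1,1; 0,1,1,1,1,1,1]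

def M₄ : Matrix (Fin 7) (Fin 7) ℚ :=
  !![0,0,0,1,0,0,0; 0,1,0,0,1,1,1; 0,0,0,1,1,1,1; 1,0,1,1,0,1,1;
     0,1,1,0,1,1,1; 0,1,1,1,1,1,1; 0,1,1,1,1,1,1]

def M₅ : Matrix (Fin 7) (Fin 7) ℚ :=
  !![0,0,0,0,1,0,0; 0,0,1,1,1,1,1; 0,1,0,1,1,1,1; 0,1,1,0,1,1,1;
     1,1,1,1,1,1,1; 0,1,1,1,1,2,1; 0,1,1,1,1,1,2]

def M₆ : Matrix (Fin 7) (Fin 7) ℚ :=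
  !![0,0,0,0,0,1,0; 0,1,1,1,1,1,1; 0,1,1,1,1,1,1; 0,1,1,1,1,1,1;
     0,1,1,1,1,2,1; 1,1,1,1,2,0,3; 0,1,1,1,1,3,1]

def M₇ : Matrix (Fin 7) (Fin 7) ℚ :=
  !![0,0,0,0,0,0,1; 0,1,1,1,1,1,1; 0,1,1,1,1,1,1; 0,1,1,1,1,1,1;
     0,1,1,1,1,1,2; 0,1,1,1,1,3,1; 1,1,1,1,2,1,2]

/-- The seven fusion matrices of the rank-7 simple integral fusion ring. -/
def M : Fin 7 → Matrix (Fin 7) (Fin 7) ℚ := ![M₁, M₂, M₃, M₄, M₅, M₆, M₇]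

/-- The last column `u = (1,0,0,0,1,−3,2)` of the character table. -/
def u : Fin 7 → ℚ := ![1, 0, 0, 0, 1, -3, 2]

/-- The Perron–Frobenius dimension vector `(1,5,5,5,6,7,7)`. -/
def d : Fin 7 → ℚ := ![1, 5, 5, 5, 6, 7, 7]

/-- The matrix `Z = Σ_j (u_j²/d_j) · M_j` of the dual Schur-product test. -/
noncomputable def Z : Matrix (Fin 7) (Fin 7) ℚ := ∑ j, (u j ^ 2 / d j) • M j

/-- The positive semidefinite test element `X = M₁ + M₅ − 3 M₆ + 2 M₇ = Σ_j u_j M_j`. -/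
noncomputable def X : Matrix (Fin 7) (Fin 7) ℚ := M₁ + M₅ - (3 : ℚ) • M₆ + (2 : ℚ) • M₇

theorem mulVec_u (j : Fin 7) : (M j).mulVec u = u j • u := by
  ext i
  fin_cases j <;> fin_cases i <;>
    norm_num [M, M₁, M₂, M₃, M₄, M₅, M₆, M₇, u, Matrix.mulVec, dotProduct, Fin.sum_univ_succ,
      Matrix.one_apply]

theorem sum_u_pow_three_div_d : ∑ j, u j ^ 3 / d j = (-65 : ℚ) / 42 := by
  norm_num [u, d, Fin.sum_univ_succ]

theorem Z_eq : Z = M₁ + (1/6 : ℚ) • M₅ + (9/7 : ℚ) • M₆ + (4/7 : ℚ) • M₇ := by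
  norm_num [Z, u, d, M, Fin.sum_univ_succ, add_assoc]

theorem Z_mulVec_u : Z.mulVec u = ((-65 : ℚ) / 42) • u := by
  rw [← sum_u_pow_three_div_d, Z, Matrix.sum_mulVec, Finset.sum_smul]
  refine Finset.sum_congr rfl fun j _ => ?_
  rw [Matrix.smul_mulVec, mulVec_u, smul_smul]
  congr 1
  ring

theorem not_posSemidef_Z : ¬ Z.PosSemidef := by
  intro h
  have hu := h.dotProduct_mulVec_nonneg u
  have huu : star u ⬝ᵥ u = 15 := by
    norm_num [u, dotProduct, Fin.sum_univ_succ]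
  rw [Z_mulVec_u, dotProduct_smul, huu] at hu
  norm_num at hu

/-- `X` is the rank-one matrix `u uᵀ`. -/
theorem X_eq_vecMulVec : X = Matrix.vecMulVec u (star u) := by
  ext i j
  fin_cases i <;> fin_cases j <;>
    norm_num [X, M₁, M₅, M₆, M₇, u, Matrix.vecMulVec_apply, Matrix.one_apply]

theorem posSemidef_X : X.PosSemidef :=
  X_eq_vecMulVec ▸ Matrix.posSemidef_vecMulVec_self_star u

open Finset Matrix in
/-- Failure of the Schur product property on the dual of the rank-7 example:
(i) `M_j · u = u_j · u` for all `j`; (ii) `Σ_j u_j³/d_j = −65/42 < 0`;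
(iii) `Z = Σ_j (u_j²/d_j) M_j = M₁ + (1/6) M₅ + (9/7) M₆ + (4/7) M₇` satisfies
`Z·u = (−65/42)·u`, hence `Z` is not positive semidefinite, even though
`X = Σ_j u_j M_j` is positive semidefinite. -/
theorem rank7_dual_schur_failure :
    (∀ j, (M j).mulVec u = u j • u) ∧
    (∑ j, u j ^ 3 / d j = (-65 : ℚ) / 42) ∧
    ((-65 : ℚ) / 42 < 0) ∧
    (Z = M₁ + (1/6 : ℚ) • M₅ + (9/7 : ℚ) • M₆ + (4/7 : ℚ) • M₇) ∧
    (Z.mulVec u = ((-65 : ℚ) / 42) • u) ∧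
    ¬ Z.PosSemidef ∧
    X.PosSemidef := by
  exact ⟨mulVec_u, sum_u_pow_three_div_d, by norm_num, Z_eq, Z_mulVec_u, not_posSemidef_Z,
    posSemidef_X⟩
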